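/- Fix β > 0, μ ∈ ℝ and σ > 0. If α₁ < α₂, then the greatest element of S(α₂, β, μ, σ) is strictly less than the greatest element of S(α₁, β, μ, σ), and the least element of S(α₂, β, μ, σ) is strictly less than the least element of S(α₁, β, μ, σ). -/

import Mathlib

open Real MeasureTheory

/-- The standard normal cumulative distribution function
`Φ(z) = (1/√(2π)) ∫_{−∞}^{z} exp(−t²/2) dt`. -/
noncomputable def stdNormalCDF (z : ℝ) : ℝ :=
  (Real.sqrt (2 * Real.pi))⁻¹ * ∫ t in Set.Iic z, Real.exp (-t ^ 2 / 2)

/-- The equilibrium solution set `S(α, β, μ, σ) = {θ : α + β·θ = Φ((θ − μ)/σ)}`. -/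
def S (α β μ σ : ℝ) : Set ℝ :=
  {θ : ℝ | α + β * θ = stdNormalCDF ((θ - μ) / σ)}

theorem integrable_exp_neg_sq_div_two : Integrable fun t : ℝ => Real.exp (-t ^ 2 / 2) := by
  convert integrable_exp_neg_mul_sq (b := 1 / 2) (by norm_num) using 3
  ring

theorem integral_exp_neg_sq_div_two :
    ∫ t : ℝ, Real.exp (-t ^ 2 / 2) = Real.sqrt (2 * Real.pi) := by
  convert integral_gaussian (1 / 2) using 4
  · ring
  · ring

theorem stdNormalCDF_nonneg (z : ℝ) : 0 ≤ stdNormalCDF z :=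
  mul_nonneg (by positivity) (integral_nonneg fun _ => (Real.exp_pos _).le)

theorem stdNormalCDF_le_one (z : ℝ) : stdNormalCDF z ≤ 1 := by
  have hle : ∫ t in Set.Iic z, Real.exp (-t ^ 2 / 2) ≤ Real.sqrt (2 * Real.pi) := by
    rw [← integral_exp_neg_sq_div_two]
    exact setIntegral_le_integral integrable_exp_neg_sq_div_two
      (Filter.Eventually.of_forall fun _ => (Real.exp_pos _).le)
  have hpos : 0 < Real.sqrt (2 * Real.pi) := by positivity
  rw [stdNormalCDF, inv_mul_le_iff₀ hpos, mul_one]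
  exact hle

theorem continuous_stdNormalCDF : Continuous stdNormalCDF := by
  have hsplit (z : ℝ) : ∫ t in Set.Iic z, Real.exp (-t ^ 2 / 2) =
      (∫ t in Set.Iic 0, Real.exp (-t ^ 2 / 2)) + ∫ t in 0..z, Real.exp (-t ^ 2 / 2) := by
    rw [← intervalIntegral.integral_Iic_sub_Iic
      integrable_exp_neg_sq_div_two.integrableOn integrable_exp_neg_sq_div_two.integrableOn]
    ring
  refine continuous_const.mul ?_
  rw [funext hsplit]
  exact continuous_const.add (intervalIntegral.continuous_primitive
    (fun _ _ => integrable_exp_neg_sq_div_two.intervalIntegrable) 0)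

/-- If the line of intercept `α` lies strictly below `Φ` at `x`, it crosses `Φ` to the right
of `x`. -/
theorem exists_gt_mem_S {α β μ σ x : ℝ} (hβ : 0 < β)
    (hx : α + β * x < stdNormalCDF ((x - μ) / σ)) : ∃ θ ∈ S α β μ σ, x < θ := by
  have hcont : Continuous fun θ => stdNormalCDF ((θ - μ) / σ) - (α + β * θ) :=
    (continuous_stdNormalCDF.comp (by fun_prop)).sub (by fun_prop)
  have hright : stdNormalCDF ((max x ((1 - α) / β) - μ) / σ) -
      (α + β * max x ((1 - α) / β)) ≤ 0 := by
    have hline := (div_le_iff₀' hβ).mp (le_max_right x ((1 - α) / β))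
    linarith [stdNormalCDF_le_one ((max x ((1 - α) / β) - μ) / σ)]
  obtain ⟨θ, hθ, hzero⟩ := intermediate_value_Icc' (le_max_left x ((1 - α) / β))
    hcont.continuousOn ⟨hright, (sub_pos.mpr hx).le⟩
  have hmem : θ ∈ S α β μ σ := (sub_eq_zero.mp hzero).symm
  exact ⟨θ, hmem, hθ.1.lt_of_ne fun h => hx.ne (h ▸ hmem)⟩

/-- If the line of intercept `α` lies strictly above `Φ` at `x`, it crosses `Φ` to the left
of `x`. -/
theorem exists_lt_mem_S {α β μ σ x : ℝ} (hβ : 0 < β)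
    (hx : stdNormalCDF ((x - μ) / σ) < α + β * x) : ∃ θ ∈ S α β μ σ, θ < x := by
  have hcont : Continuous fun θ => stdNormalCDF ((θ - μ) / σ) - (α + β * θ) :=
    (continuous_stdNormalCDF.comp (by fun_prop)).sub (by fun_prop)
  have hleft : 0 ≤ stdNormalCDF ((min x (-α / β) - μ) / σ) - (α + β * min x (-α / β)) := by
    have hline := (le_div_iff₀' hβ).mp (min_le_right x (-α / β))
    linarith [stdNormalCDF_nonneg ((min x (-α / β) - μ) / σ)]
  obtain ⟨θ, hθ, hzero⟩ := intermediate_value_Icc' (min_le_left x (-α / β))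
    hcont.continuousOn ⟨(sub_neg.mpr hx).le, hleft⟩
  have hmem : θ ∈ S α β μ σ := (sub_eq_zero.mp hzero).symm
  exact ⟨θ, hmem, hθ.2.lt_of_ne fun h => hx.ne' (h ▸ hmem)⟩

/-- Proposition 3(iii) applied to costs: the greatest and least elements of
`S(α, β, μ, σ)` (the high- and low-protest equilibrium thresholds) are strictly
decreasing in `α = (c + k₁)/k₁`, i.e. in the cost of protest. -/
theorem stmt14 (β μ σ : ℝ) (hβ : 0 < β) (hσ : 0 < σ) :
    ∀ α₁ α₂ g₁ g₂ l₁ l₂ : ℝ, α₁ < α₂ →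
      IsGreatest (S α₁ β μ σ) g₁ → IsGreatest (S α₂ β μ σ) g₂ →
      IsLeast (S α₁ β μ σ) l₁ → IsLeast (S α₂ β μ σ) l₂ →
      g₂ < g₁ ∧ l₂ < l₁ := by
  intro α₁ α₂ g₁ g₂ l₁ l₂ hα hg₁ hg₂ hl₁ hl₂
  have hg₂_eq : α₂ + β * g₂ = stdNormalCDF ((g₂ - μ) / σ) := hg₂.1
  have hl₁_eq : α₁ + β * l₁ = stdNormalCDF ((l₁ - μ) / σ) := hl₁.1
  obtain ⟨θ, hθ, hgt⟩ := exists_gt_mem_S (α := α₁) (σ := σ) (μ := μ) hβ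
    (x := g₂) (by linarith)
  obtain ⟨η, hη, hlt⟩ := exists_lt_mem_S (α := α₂) (σ := σ) (μ := μ) hβ
    (x := l₁) (by linarith)
  exact ⟨hgt.trans_le (hg₁.2 hθ), (hl₂.2 hη).trans_lt hlt⟩
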